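/- Let n ≥ 8, let H0 be a hierarchy on [n] with induced triplet set T0 and AddS3 similarities s_{0ij} (computed from T0), and let T be the random subset of T0 in which, independently for each pair of triplets {(i,j,k),(j,i,k)} ⊆ T0 with i<j, both triplets are included with probability p ∈ (0,1]. Let s_{ij} denote the AddS3 similarities computed from T. For any α > 0, if p > (α+2)·log n / n, then with probability at least 1 − 2n^{−α}, both p·n³/10 ≤ |T| ≤ p·n³/2 and max_{1≤i<j≤n} |s_{ij} − p·s_{0ij}| ≤ 4·√((α+2)·p·n·log n) hold. -/

import Mathlib

open Finset MeasureTheory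

namespace CompHC

/-- A rooted binary tree with leaves labelled by elements of `Fin n`. -/
inductive HTree (n : ℕ) : Type
  | leaf (i : Fin n) : HTree n
  | node (l r : HTree n) : HTree n

namespace HTree

/-- The list of leaf labels of a tree. -/
def leaves {n : ℕ} : HTree n → List (Fin n)
  | .leaf i => [i]
  | .node l r => l.leaves ++ r.leaves

/-- The number of leaves of a tree. -/
def size {n : ℕ} (t : HTree n) : ℕ := t.leaves.length

/-- `|H(i ∨ j)|`: the number of leaves of the smallest subtree containing both `i` and `j`. -/
def lcaSize {n : ℕ} : HTree n → Fin n → Fin n → ℕ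
  | .leaf _, _, _ => 1
  | .node l r, i, j =>
      if i ∈ l.leaves ∧ j ∈ l.leaves then l.lcaSize i j
      else if i ∈ r.leaves ∧ j ∈ r.leaves then r.lcaSize i j
      else l.size + r.size

/-- Sum of `f |N1| |N2|` over the internal nodes `N` of the tree, `N1, N2` its children. -/
def internalSum {n : ℕ} (f : ℕ → ℕ → ℕ) : HTree n → ℕ
  | .leaf _ => 0
  | .node l r => f l.size r.size + l.internalSum f + r.internalSum f

end HTree

/-- A hierarchy on `[n]`: every object appears exactly once as a leaf. -/
def IsHierarchy {n : ℕ} (t : HTree n) : Prop :=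
  t.leaves.Nodup ∧ ∀ i : Fin n, i ∈ t.leaves

abbrev Triplet (n : ℕ) := Fin n × Fin n × Fin n
abbrev Quadruplet (n : ℕ) := Fin n × Fin n × Fin n × Fin n

/-- The entries of a triplet are pairwise distinct. -/
def distinctTriplet {n : ℕ} (t : Triplet n) : Prop :=
  t.1 ≠ t.2.1 ∧ t.1 ≠ t.2.2 ∧ t.2.1 ≠ t.2.2

/-- A quadruplet `(i,j,k,l)` satisfies `i<j`, `k<l`, `(i,j) ≠ (k,l)`. -/
def validQuadruplet {n : ℕ} (q : Quadruplet n) : Prop :=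
  q.1 < q.2.1 ∧ q.2.2.1 < q.2.2.2 ∧ (q.1, q.2.1) ≠ (q.2.2.1, q.2.2.2)

/-- Triplet revenue `Trev(H,T) = Σ_{(i,j,k)∈T} (|H(i∨k)| − |H(i∨j)|)`. -/
def Trev {n : ℕ} (H : HTree n) (T : Finset (Triplet n)) : ℤ :=
  ∑ t ∈ T, ((H.lcaSize t.1 t.2.2 : ℤ) - (H.lcaSize t.1 t.2.1 : ℤ))

/-- Quadruplet revenue `Qrev(H,Q) = Σ_{(i,j,k,l)∈Q} (|H(k∨l)| − |H(i∨j)|)`. -/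
def Qrev {n : ℕ} (H : HTree n) (Q : Finset (Quadruplet n)) : ℤ :=
  ∑ q ∈ Q, ((H.lcaSize q.2.2.1 q.2.2.2 : ℤ) - (H.lcaSize q.1 q.2.1 : ℤ))

/-- The set of pairs `(i,j)` with `i < j`. -/
def pairs (n : ℕ) : Finset (Fin n × Fin n) :=
  Finset.univ.filter fun p => p.1 < p.2

/-- Dasgupta's cost `Dcost(H,s) = Σ_{i<j} s_{ij}·|H(i∨j)|`. -/
noncomputable def Dcost {n : ℕ} (H : HTree n) (s : Fin n → Fin n → ℝ) : ℝ :=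
  ∑ p ∈ pairs n, s p.1 p.2 * (H.lcaSize p.1 p.2 : ℝ)

/-- The AddS3 similarity computed from a triplet set. -/
def sAddS3 {n : ℕ} (T : Finset (Triplet n)) (i j : Fin n) : ℤ :=
  ∑ k ∈ Finset.univ.filter (fun k : Fin n => k ≠ i ∧ k ≠ j),
    (((if (i, j, k) ∈ T then 1 else 0) - (if (i, k, j) ∈ T then 1 else 0)
      + (if (j, i, k) ∈ T then 1 else 0) - (if (j, k, i) ∈ T then 1 else 0) : ℤ))

/-- The AddS4 similarity computed from a quadruplet set. -/
def sAddS4 {n : ℕ} (Q : Finset (Quadruplet n)) (i j : Fin n) : ℤ :=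
  ∑ p ∈ (pairs n).filter (fun p => p ≠ (i, j)),
    (((if (i, j, p.1, p.2) ∈ Q then 1 else 0)
      - (if (p.1, p.2, i, j) ∈ Q then 1 else 0) : ℤ))

/-- The triplet set induced by a hierarchy `H0`:
`T0 = {(i,j,k) : i,j,k pairwise distinct, |H0(i∨j)| < min(|H0(i∨k)|, |H0(j∨k)|)}`. -/
def inducedTriplets {n : ℕ} (H : HTree n) : Finset (Triplet n) :=
  Finset.univ.filter fun t : Triplet n =>
    t.1 ≠ t.2.1 ∧ t.1 ≠ t.2.2 ∧ t.2.1 ≠ t.2.2 ∧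
    H.lcaSize t.1 t.2.1 < min (H.lcaSize t.1 t.2.2) (H.lcaSize t.2.1 t.2.2)

/-- Bernoulli measure on `Bool` with success probability `p`. -/
noncomputable def bern (p : ℝ) : Measure Bool :=
  (ENNReal.ofReal p) • Measure.dirac true + (ENNReal.ofReal (1 - p)) • Measure.dirac false

/-- Product measure of i.i.d. Bernoulli(p) coins, one for each pair of triplets
`{(i,j,k),(j,i,k)}` (indexed by triplets; only keys `(i,j,k)` with `i ≤ j` are used). -/
noncomputable def sampleMeasure (n : ℕ) (p : ℝ) : Measure (Triplet n → Bool) :=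
  Measure.pi fun _ => bern p

/-- The common key of the pair of triplets `{(i,j,k),(j,i,k)}`. -/
def pairKey {n : ℕ} (t : Triplet n) : Triplet n := (min t.1 t.2.1, max t.1 t.2.1, t.2.2)

/-- The random subset `T ⊆ T0`: the pair `{(i,j,k),(j,i,k)}` is included iff its coin is true. -/
def sampledT {n : ℕ} (H0 : HTree n) (ω : Triplet n → Bool) : Finset (Triplet n) :=
  (inducedTriplets H0).filter fun t => ω (pairKey t) = true

/-- The key of the flipping coin `ζ^i_{jk}` for the triplets `(i,j,k)` and `(i,k,j)`. -/
def flipKey {n : ℕ} (t : Triplet n) : Triplet n := (t.1, min t.2.1 t.2.2, max t.2.1 t.2.2)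

/-- Flipping a triplet: `(i,j,k) ↦ (i,k,j)`. -/
def flipTriplet {n : ℕ} (t : Triplet n) : Triplet n := (t.1, t.2.2, t.2.1)

/-- Product measure: independent Bernoulli(p) sampling coins (left index) and
Bernoulli(δ) flipping coins (right index). -/
noncomputable def noisyMeasure (n : ℕ) (p δ : ℝ) :
    Measure ((Triplet n ⊕ Triplet n) → Bool) :=
  Measure.pi fun idx => Sum.elim (fun _ : Triplet n => bern p) (fun _ : Triplet n => bern δ) idx

/-- The noisy random triplet set `T'`: sample pairs from `T0` with probability `p`, then flip
each sampled triplet `(i,j,k)` to `(i,k,j)` independently with probability `δ`. -/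
def noisySampledT {n : ℕ} (H0 : HTree n) (ω : (Triplet n ⊕ Triplet n) → Bool) :
    Finset (Triplet n) :=
  ((inducedTriplets H0).filter fun t => ω (Sum.inl (pairKey t)) = true).image
    fun t => if ω (Sum.inr (flipKey t)) = true then flipTriplet t else t

namespace HTree

lemma size_pos {n : ℕ} (t : HTree n) : 0 < t.size := by
  induction t with
  | leaf i => simp [size, leaves]
  | node l r hl hr => simp only [size, leaves, List.length_append] at *; omega

lemma size_node {n : ℕ} (l r : HTree n) : (node l r).size = l.size + r.size := by
  simp [size, leaves]

lemma lcaSize_le_size {n : ℕ} (t : HTree n) (i j : Fin n) : t.lcaSize i j ≤ t.size := by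
  induction t with
  | leaf i => simp [size, leaves, lcaSize]
  | node l r hl hr =>
    rw [size_node, lcaSize]
    split_ifs <;> omega

lemma lcaSize_comm {n : ℕ} (t : HTree n) (i j : Fin n) : t.lcaSize i j = t.lcaSize j i := by
  induction t with
  | leaf i => simp [lcaSize]
  | node l r hl hr => simp only [lcaSize, hl, hr, and_comm]

/-- Among three distinct leaves, exactly one pair has a strictly smaller least common ancestor
than the other two pairs, which share theirs. -/
lemma lcaSize_trichotomy {n : ℕ} (t : HTree n) (ht : t.leaves.Nodup) {i j k : Fin n}
    (hi : i ∈ t.leaves) (hj : j ∈ t.leaves) (hk : k ∈ t.leaves)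
    (hij : i ≠ j) :
    (t.lcaSize i j < t.lcaSize i k ∧ t.lcaSize i k = t.lcaSize j k) ∨
    (t.lcaSize i k < t.lcaSize i j ∧ t.lcaSize i j = t.lcaSize j k) ∨
    (t.lcaSize j k < t.lcaSize i j ∧ t.lcaSize i j = t.lcaSize i k) := by
  induction t with
  | leaf a => simp only [leaves, List.mem_singleton] at hi hj; exact absurd (hi.trans hj.symm) hij
  | node l r hl hr =>
    simp only [leaves, List.mem_append, List.nodup_append] at hi hj hk ht
    obtain ⟨hnl, hnr, hd⟩ := ht
    have disj : ∀ a, a ∈ l.leaves → a ∉ r.leaves := fun a h h' => hd a h a h' rfl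
    have disj' : ∀ a, a ∈ r.leaves → a ∉ l.leaves := fun a h h' => hd a h' a h rfl
    have hl1 := l.size_pos
    have hr1 := r.size_pos
    have ll := l.lcaSize_le_size
    have rl := r.lcaSize_le_size
    have := ll i j
    have := ll i k
    have := ll j k
    have := rl i j
    have := rl i k
    have := rl j k
    rcases hi with hi | hi <;> rcases hj with hj | hj <;> rcases hk with hk | hk
    · simpa [lcaSize, hi, hj, hk] using hl hnl hi hj hk
    · simp [lcaSize, hi, hj, hk, disj _ hi, disj _ hj, disj' _ hk]; omega
    · simp [lcaSize, hi, hj, hk, disj _ hi, disj _ hk, disj' _ hj]; omega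
    · simp [lcaSize, hi, hj, hk, disj _ hi, disj' _ hk, disj' _ hj]; omega
    · simp [lcaSize, hi, hj, hk, disj' _ hi, disj _ hk, disj _ hj]; omega
    · simp [lcaSize, hi, hj, hk, disj' _ hi, disj' _ hk, disj _ hj]; omega
    · simp [lcaSize, hi, hj, hk, disj' _ hi, disj _ hk, disj' _ hj]; omega
    · simpa [lcaSize, hi, hj, hk, disj' _ hi, disj' _ hk, disj' _ hj] using hr hnr hi hj hk

end HTree

lemma mem_inducedTriplets_comm {n : ℕ} (H : HTree n) (i j k : Fin n) :
    (i, j, k) ∈ inducedTriplets H ↔ (j, i, k) ∈ inducedTriplets H := by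
  simp only [inducedTriplets, mem_filter, mem_univ, true_and, H.lcaSize_comm j i, min_comm,
    ne_comm (a := j) (b := i)]
  tauto

/-- For distinct `i, j, k` exactly one of the three pairs of triplets on `{i, j, k}` is induced. -/
lemma inducedTriplets_trichotomy {n : ℕ} {H : HTree n} (hH : IsHierarchy H) {i j k : Fin n}
    (hij : i ≠ j) (hik : i ≠ k) (hjk : j ≠ k) :
    ((i, j, k) ∈ inducedTriplets H ∧ (i, k, j) ∉ inducedTriplets H ∧
      (j, k, i) ∉ inducedTriplets H) ∨
    ((i, j, k) ∉ inducedTriplets H ∧ (i, k, j) ∈ inducedTriplets H ∧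
      (j, k, i) ∉ inducedTriplets H) ∨
    ((i, j, k) ∉ inducedTriplets H ∧ (i, k, j) ∉ inducedTriplets H ∧
      (j, k, i) ∈ inducedTriplets H) := by
  have := H.lcaSize_trichotomy hH.1 (hH.2 i) (hH.2 j) (hH.2 k) hij
  simp only [inducedTriplets, mem_filter, mem_univ, true_and, lt_min_iff, H.lcaSize_comm j i,
    H.lcaSize_comm k j, H.lcaSize_comm k i, hij, hik, hjk, hij.symm, hik.symm, hjk.symm, ne_eq,
    not_false_iff]
  omega

lemma card_distinctTriplets (n : ℕ) :
    (univ.filter fun t : Triplet n => t.1 ≠ t.2.1 ∧ t.1 ≠ t.2.2 ∧ t.2.1 ≠ t.2.2).card =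
      n * (n - 1) * (n - 2) := by
  have h2 : ∀ i j : Fin n, i ≠ j →
      (univ.filter fun k : Fin n => i ≠ k ∧ j ≠ k).card = n - 2 := by
    intro i j hij
    have : (univ.filter fun k : Fin n => i ≠ k ∧ j ≠ k) = univ \ {i, j} := by
      ext k; simp [eq_comm]
    rw [this, card_sdiff_of_subset (subset_univ _), card_pair hij]; simp
  have h1 : ∀ i : Fin n, (univ.filter fun j : Fin n => i ≠ j).card = n - 1 := by
    intro i
    rw [filter_ne, card_erase_of_mem (mem_univ _)]; simp
  rw [card_filter, Fintype.sum_prod_type]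
  simp only [Fintype.sum_prod_type]
  have : ∀ i j : Fin n, (∑ k, if i ≠ j ∧ i ≠ k ∧ j ≠ k then 1 else 0) =
      if i ≠ j then n - 2 else 0 := by
    intro i j
    by_cases h : i = j
    · simp [h]
    · rw [if_pos h, ← h2 i j h, card_filter]; simp [h]
  simp_rw [this, ← sum_filter, sum_const, h1]
  simp [mul_assoc]

lemma three_mul_card_inducedTriplets {n : ℕ} {H : HTree n} (hH : IsHierarchy H) :
    3 * (inducedTriplets H).card = n * (n - 1) * (n - 2) := by
  rw [← card_distinctTriplets, card_filter]
  have key : ∀ t : Triplet n,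
      (if t.1 ≠ t.2.1 ∧ t.1 ≠ t.2.2 ∧ t.2.1 ≠ t.2.2 then 1 else 0) =
      (if t ∈ inducedTriplets H then 1 else 0) +
      (if (t.1, t.2.2, t.2.1) ∈ inducedTriplets H then 1 else 0) +
      (if (t.2.1, t.2.2, t.1) ∈ inducedTriplets H then 1 else 0) := by
    rintro ⟨i, j, k⟩
    by_cases h : i ≠ j ∧ i ≠ k ∧ j ≠ k
    · obtain ⟨h1, h2, h3⟩ := h
      rcases inducedTriplets_trichotomy hH h1 h2 h3 with h | h | h <;>
        simp [h.1, h.2.1, h.2.2, h1, h2, h3]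
    · rw [if_neg h, if_neg, if_neg, if_neg] <;>
      · simp only [inducedTriplets, mem_filter]; tauto
  simp_rw [key, sum_add_distrib]
  have e1 : ∑ t : Triplet n, (if (t.1, t.2.2, t.2.1) ∈ inducedTriplets H then 1 else 0) =
      ∑ t : Triplet n, (if t ∈ inducedTriplets H then 1 else 0) := by
    refine Finset.sum_nbij' (fun t => (t.1, t.2.2, t.2.1)) (fun t => (t.1, t.2.2, t.2.1)) ?_ ?_ ?_ ?_
      ?_ <;> simp
  have e2 : ∑ t : Triplet n, (if (t.2.1, t.2.2, t.1) ∈ inducedTriplets H then 1 else 0) =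
      ∑ t : Triplet n, (if t ∈ inducedTriplets H then 1 else 0) := by
    refine Finset.sum_nbij' (fun t => (t.2.1, t.2.2, t.1)) (fun t => (t.2.2, t.1, t.2.1)) ?_ ?_ ?_ ?_
      ?_ <;> simp
  rw [e1, e2]
  simp
  omega

/-- One representative of each pair of induced triplets. -/
def inducedKeys {n : ℕ} (H : HTree n) : Finset (Triplet n) :=
  (inducedTriplets H).filter fun t => t.1 < t.2.1

lemma pairKey_of_lt {n : ℕ} {t : Triplet n} (h : t.1 < t.2.1) : pairKey t = t := by
  simp [pairKey, h.le]

lemma pairKey_comm {n : ℕ} (i j k : Fin n) : pairKey (i, j, k) = pairKey (j, i, k) := by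
  simp [pairKey, min_comm, max_comm]

lemma card_sampledT {n : ℕ} (H : HTree n) (ω : Triplet n → Bool) :
    (sampledT H ω).card = 2 * ∑ t ∈ inducedKeys H, if ω t = true then 1 else 0 := by
  have e1 : (∑ t ∈ inducedKeys H, if ω t = true then 1 else 0) =
      ((sampledT H ω).filter fun t => t.1 < t.2.1).card := by
    rw [← card_filter]
    congr 1
    ext t
    simp only [inducedKeys, sampledT, mem_filter]
    constructor
    · rintro ⟨⟨h1, h2⟩, h3⟩
      rw [pairKey_of_lt h2]; tauto
    · rintro ⟨⟨h1, h2⟩, h3⟩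
      rw [pairKey_of_lt h3] at h2; tauto
  have e2 : ((sampledT H ω).filter fun t => ¬ t.1 < t.2.1).card =
      ((sampledT H ω).filter fun t => t.1 < t.2.1).card := by
    refine Finset.card_nbij' (fun t => (t.2.1, t.1, t.2.2)) (fun t => (t.2.1, t.1, t.2.2))
      ?_ ?_ ?_ ?_
    · rintro ⟨i, j, k⟩ h
      simp only [sampledT, mem_coe, mem_filter] at h ⊢
      rw [mem_inducedTriplets_comm, pairKey_comm j i]
      refine ⟨h.1, lt_of_le_of_ne (not_lt.1 h.2) ?_⟩
      have := h.1.1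
      simp only [inducedTriplets, mem_filter] at this
      exact this.2.1.symm
    · rintro ⟨i, j, k⟩ h
      simp only [sampledT, mem_coe, mem_filter] at h ⊢
      rw [mem_inducedTriplets_comm, pairKey_comm j i]
      exact ⟨h.1, h.2.asymm⟩
    · intro t _; rfl
    · intro t _; rfl
  rw [e1, two_mul]
  nth_rw 2 [← e2]
  exact (card_filter_add_card_filter_not _).symm

lemma sampledT_true {n : ℕ} (H : HTree n) : sampledT H (fun _ => true) = inducedTriplets H := by
  simp [sampledT]

lemma six_mul_card_inducedKeys {n : ℕ} {H : HTree n} (hH : IsHierarchy H) :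
    6 * (inducedKeys H).card = n * (n - 1) * (n - 2) := by
  have := card_sampledT H (fun _ => true)
  rw [sampledT_true] at this
  rw [← three_mul_card_inducedTriplets hH, this]
  simp
  ring

/-- Each `k` contributes to the sampled AddS3 similarity of `i, j` through a single coin. -/
lemma exists_key_sAddS3 {n : ℕ} {H : HTree n} (hH : IsHierarchy H) {i j : Fin n} (hij : i ≠ j) :
    ∃ (K : Fin n → Triplet n) (a : Fin n → ℝ),
      Set.InjOn K (univ.filter fun k : Fin n => k ≠ i ∧ k ≠ j) ∧ (∀ k, |a k| ≤ 2) ∧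
      ∀ ω, (sAddS3 (sampledT H ω) i j : ℝ) =
        ∑ k ∈ univ.filter (fun k : Fin n => k ≠ i ∧ k ≠ j),
          a k * if ω (K k) = true then 1 else 0 := by
  have key : ∀ k : Fin n, ∃ (t : Triplet n) (a : ℝ), k ≠ i → k ≠ j →
      (∀ x, (x = t.1 ∨ x = t.2.1 ∨ x = t.2.2) ↔ (x = i ∨ x = j ∨ x = k)) ∧ |a| ≤ 2 ∧
      ∀ ω, (((if (i, j, k) ∈ sampledT H ω then 1 else 0) -
        (if (i, k, j) ∈ sampledT H ω then 1 else 0)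
        + (if (j, i, k) ∈ sampledT H ω then 1 else 0) -
        (if (j, k, i) ∈ sampledT H ω then 1 else 0) : ℤ) : ℝ) =
        a * if ω t = true then 1 else 0 := by
    intro k
    by_cases h : k ≠ i ∧ k ≠ j
    swap
    · exact ⟨(i, j, k), 0, fun h1 h2 => absurd ⟨h1, h2⟩ h⟩
    have hpk : ∀ a b c x : Fin n, (x = (pairKey (a, b, c)).1 ∨ x = (pairKey (a, b, c)).2.1 ∨
        x = (pairKey (a, b, c)).2.2) ↔ (x = a ∨ x = b ∨ x = c) := by
      intro a b c x
      rcases le_total a b with h | h <;> simp [pairKey, h]; tauto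
    have hc := mem_inducedTriplets_comm H j i k
    rcases inducedTriplets_trichotomy hH hij h.1.symm h.2.symm with h' | h' | h'
    · refine ⟨pairKey (i, j, k), 2, fun _ _ => ⟨hpk _ _ _, by norm_num, fun ω => ?_⟩⟩
      simp only [sampledT, mem_filter, h'.1, h'.2.1, h'.2.2, hc, pairKey_comm j i k]
      split_ifs <;> simp_all
    · refine ⟨pairKey (i, k, j), -1, fun _ _ =>
        ⟨fun x => by rw [hpk]; tauto, by norm_num, fun ω => ?_⟩⟩
      simp only [sampledT, mem_filter, h'.1, h'.2.1, h'.2.2, hc]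
      split_ifs <;> simp_all
    · refine ⟨pairKey (j, k, i), -1, fun _ _ =>
        ⟨fun x => by rw [hpk]; tauto, by norm_num, fun ω => ?_⟩⟩
      simp only [sampledT, mem_filter, h'.1, h'.2.1, h'.2.2, hc]
      split_ifs <;> simp_all
  choose K a h using key
  refine ⟨K, fun k => if k ≠ i ∧ k ≠ j then a k else 0, ?_, ?_, ?_⟩
  · intro k hk k' hk' e
    simp only [coe_filter, mem_univ, true_and, Set.mem_ofPred_eq] at hk hk'
    have h1 := (h k hk.1 hk.2).1 k
    have h2 := (h k' hk'.1 hk'.2).1 k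
    rw [e] at h1
    have := h2.1 (h1.2 (Or.inr (Or.inr rfl)))
    tauto
  · intro k
    dsimp only
    split_ifs with hk
    · exact (h k hk.1 hk.2).2.1
    · simp
  · intro ω
    rw [sAddS3, Int.cast_sum]
    refine sum_congr rfl fun k hk => ?_
    simp only [mem_filter, mem_univ, true_and] at hk
    dsimp only
    rw [(h k hk.1 hk.2).2.2 ω, if_pos hk]

open ProbabilityTheory

lemma isProbabilityMeasure_bern {p : ℝ} (hp0 : 0 ≤ p) (hp1 : p ≤ 1) :
    IsProbabilityMeasure (bern p) := by
  constructor
  simp only [bern, Measure.coe_add, Measure.coe_smul, Pi.add_apply, Pi.smul_apply, measure_univ,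
    smul_eq_mul, mul_one]
  rw [← ENNReal.ofReal_add hp0 (by linarith)]
  simp

lemma integral_bern {p : ℝ} (hp0 : 0 ≤ p) (hp1 : p ≤ 1) (f : Bool → ℝ) :
    ∫ b, f b ∂(bern p) = p * f true + (1 - p) * f false := by
  rw [bern, integral_add_measure, integral_smul_measure, integral_smul_measure, integral_dirac,
    integral_dirac, ENNReal.toReal_ofReal hp0, ENNReal.toReal_ofReal (by linarith)]
  · simp
  · exact (integrable_dirac (by simp)).smul_measure (by simp)
  · exact (integrable_dirac (by simp)).smul_measure (by simp)

lemma isProbabilityMeasure_sampleMeasure (n : ℕ) {p : ℝ} (hp0 : 0 ≤ p) (hp1 : p ≤ 1) :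
    IsProbabilityMeasure (sampleMeasure n p) := by
  have := isProbabilityMeasure_bern hp0 hp1
  unfold sampleMeasure
  infer_instance

/-- The indicator of an included pair, as a real number. -/
def coin (b : Bool) : ℝ := if b = true then 1 else 0

/-- The exponential Markov inequality for weighted sums of distinct centered coins. -/
lemma sampleMeasure_real_le_exp {n : ℕ} {p : ℝ} (hp0 : 0 ≤ p) (hp1 : p ≤ 1) {ι : Type*}
    (S : Finset ι) (K : ι → Triplet n) (hK : Set.InjOn K S) (a : ι → ℝ) (d : ℝ) :
    (sampleMeasure n p).real {ω | d ≤ ∑ k ∈ S, a k * (coin (ω (K k)) - p)} ≤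
      Real.exp (p * ∑ k ∈ S, (Real.exp (a k) - 1 - a k) - d) := by
  have hb := isProbabilityMeasure_bern hp0 hp1
  have hs := isProbabilityMeasure_sampleMeasure n hp0 hp1
  have hcoord : iIndepFun (fun (t : Triplet n) (ω : Triplet n → Bool) => ω t)
      (sampleMeasure n p) :=
    iIndepFun_pi (X := fun _ b => b) fun _ => aemeasurable_id
  have hsub := hcoord.precomp (g := fun k : S => K k) fun x y h => Subtype.ext (hK x.2 y.2 h)
  have hX := hsub.comp (fun (k : S) b => a k * (coin b - p)) fun _ => measurable_of_finite _
  have hmgf := hX.mgf_sum (t := 1) (fun _ => measurable_of_finite _) univ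
  have hsum : ∀ ω : Triplet n → Bool, (∑ k ∈ S, a k * (coin (ω (K k)) - p)) =
      (∑ k : S, (fun b => a k * (coin b - p)) ∘ fun ω : Triplet n → Bool => ω (K k)) ω := by
    intro ω
    rw [← sum_coe_sort S]
    simp
  simp_rw [hsum]
  refine (measure_ge_le_exp_mul_mgf (t := 1) d zero_le_one .of_finite).trans ?_
  rw [hmgf, sub_eq_neg_add, Real.exp_add, mul_sum, Real.exp_sum, ← prod_coe_sort S, neg_one_mul]
  refine mul_le_mul_of_nonneg_left (prod_le_prod (fun _ _ => mgf_nonneg) fun k _ => ?_)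
    (Real.exp_nonneg _)
  have hcoin : mgf ((fun b => a k * (coin b - p)) ∘ fun ω : Triplet n → Bool => ω (K k))
      (sampleMeasure n p) 1 = ∫ b, Real.exp (a k * (coin b - p)) ∂(bern p) := by
    have := (measurePreserving_eval (fun _ : Triplet n => bern p) (K k)).map_eq
    rw [← this, integral_map (measurable_pi_apply _).aemeasurable
      (measurable_of_finite _).aestronglyMeasurable]
    simp [mgf, sampleMeasure]
  rw [hcoin, integral_bern hp0 hp1]
  have h1 : Real.exp (a k * (coin true - p)) = Real.exp (a k) * Real.exp (-(p * a k)) := by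
    rw [← Real.exp_add]; congr 1; simp [coin]; ring
  have h2 : Real.exp (a k * (coin false - p)) = Real.exp (-(p * a k)) := by
    congr 1; simp [coin]; ring
  have h3 : Real.exp (p * (Real.exp (a k) - 1 - a k)) =
      Real.exp (p * (Real.exp (a k) - 1)) * Real.exp (-(p * a k)) := by
    rw [← Real.exp_add]; congr 1; ring
  rw [h1, h2, h3]
  have := Real.add_one_le_exp (p * (Real.exp (a k) - 1))
  have := mul_le_mul_of_nonneg_right this (Real.exp_nonneg (-(p * a k)))
  linarith

lemma sAddS3_tail {n : ℕ} {H : HTree n} (hH : IsHierarchy H) {p : ℝ} (hp0 : 0 ≤ p) (hp1 : p ≤ 1)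
    {L : ℝ} (hL : 0 < L) (hpn : L ≤ p * n) {i j : Fin n} (hij : i ≠ j) :
    (sampleMeasure n p).real {ω | 4 * Real.sqrt (L * (p * n)) <
      |(sAddS3 (sampledT H ω) i j : ℝ) - p * (sAddS3 (inducedTriplets H) i j : ℝ)|} ≤
      2 * Real.exp (-L) := by
  have := isProbabilityMeasure_sampleMeasure n hp0 hp1
  obtain ⟨K, a, hK, ha, hs⟩ := exists_key_sAddS3 hH hij
  set S := univ.filter fun k : Fin n => k ≠ i ∧ k ≠ j
  set u := Real.sqrt (L * (p * n)) with hu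
  have hu2 : u ^ 2 = L * (p * n) := Real.sq_sqrt (by positivity)
  have hLu : L ≤ u := Real.le_sqrt_of_sq_le (by nlinarith)
  have hu0 : 0 < u := hL.trans_le hLu
  have hdev : ∀ ω, (sAddS3 (sampledT H ω) i j : ℝ) - p * (sAddS3 (inducedTriplets H) i j : ℝ) =
      ∑ k ∈ S, a k * (coin (ω (K k)) - p) := by
    intro ω
    rw [hs ω, ← sampledT_true, hs, mul_sum, ← sum_sub_distrib]
    refine sum_congr rfl fun k _ => ?_
    simp only [coin, if_true]
    ring
  have hcard : (S.card : ℝ) ≤ n := by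
    have := card_le_univ S
    rw [Fintype.card_fin] at this
    exact_mod_cast this
  have key : ∀ c : ℝ, |c| = L / (2 * u) →
      (sampleMeasure n p).real {ω | 2 * L ≤ ∑ k ∈ S, (c * a k) * (coin (ω (K k)) - p)} ≤
        Real.exp (-L) := by
    intro c hc
    refine (sampleMeasure_real_le_exp hp0 hp1 S K hK _ _).trans (Real.exp_le_exp.2 ?_)
    have hb : ∀ k ∈ S, Real.exp (c * a k) - 1 - c * a k ≤ (L / u) ^ 2 := by
      intro k _
      have h1 : |c * a k| ≤ L / u := by
        rw [abs_mul, hc]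
        calc L / (2 * u) * |a k| ≤ L / (2 * u) * 2 := by gcongr; exact ha k
          _ = L / u := by field_simp
      have h2 : L / u ≤ 1 := (div_le_one hu0).2 hLu
      calc _ ≤ _ := le_abs_self _
        _ ≤ (c * a k) ^ 2 := Real.abs_exp_sub_one_sub_id_le (h1.trans h2)
        _ = |c * a k| ^ 2 := (sq_abs _).symm
        _ ≤ _ := by gcongr
    have h3 := sum_le_card_nsmul S _ _ hb
    rw [nsmul_eq_mul] at h3
    have h4 : p * ∑ k ∈ S, (Real.exp (c * a k) - 1 - c * a k) ≤ p * (n * (L / u) ^ 2) := by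
      gcongr
      exact h3.trans (by gcongr)
    have h5 : p * (n * (L / u) ^ 2) = L := by
      rw [div_pow, hu2]
      have : p * n ≠ 0 := (hL.trans_le hpn).ne'
      rw [← mul_assoc, ← mul_div_assoc, div_eq_iff (mul_ne_zero hL.ne' this)]
      ring
    linarith
  have hsub : {ω | 4 * u < |(sAddS3 (sampledT H ω) i j : ℝ) -
      p * (sAddS3 (inducedTriplets H) i j : ℝ)|} ⊆
      {ω | 2 * L ≤ ∑ k ∈ S, (L / (2 * u) * a k) * (coin (ω (K k)) - p)} ∪
      {ω | 2 * L ≤ ∑ k ∈ S, (-(L / (2 * u)) * a k) * (coin (ω (K k)) - p)} := by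
    intro ω hω
    simp only [Set.mem_ofPred_eq, Set.mem_union, hdev, mul_assoc, ← mul_sum] at hω ⊢
    have h2L : 2 * L = L / (2 * u) * (4 * u) := by field_simp; norm_num
    have hpos : 0 < L / (2 * u) := by positivity
    rw [h2L, neg_mul, ← mul_neg]
    rcases lt_abs.1 hω with h | h
    · exact Or.inl (mul_le_mul_of_nonneg_left h.le hpos.le)
    · exact Or.inr (mul_le_mul_of_nonneg_left h.le hpos.le)
  have hpos : 0 ≤ L / (2 * u) := by positivity
  have k1 := key (L / (2 * u)) (abs_of_nonneg hpos)
  have k2 := key (-(L / (2 * u))) (by rw [abs_neg, abs_of_nonneg hpos])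
  refine (measureReal_mono hsub).trans ((measureReal_union_le _ _).trans ?_)
  linarith

lemma card_sampledT_eq_sum_coin {n : ℕ} (H : HTree n) (ω : Triplet n → Bool) :
    ((sampledT H ω).card : ℝ) = 2 * ∑ t ∈ inducedKeys H, coin (ω t) := by
  rw [card_sampledT]
  push_cast
  rfl

lemma card_inducedKeys_cast {n : ℕ} {H : HTree n} (hH : IsHierarchy H) (hn : 2 ≤ n) :
    ((inducedKeys H).card : ℝ) = n * (n - 1) * (n - 2) / 6 := by
  have := six_mul_card_inducedKeys hH
  obtain ⟨m, rfl⟩ := Nat.exists_eq_add_of_le hn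
  rw [show 2 + m - 1 = m + 1 by omega, show 2 + m - 2 = m by omega] at this
  have h : (6 : ℝ) * (inducedKeys H).card = ((2 + m : ℕ) : ℝ) * (m + 1) * m := by
    exact_mod_cast this
  push_cast at h ⊢
  linarith

lemma card_sampledT_upper_tail {n : ℕ} {H : HTree n} (hH : IsHierarchy H) (hn : 8 ≤ n)
    {p : ℝ} (hp0 : 0 ≤ p) (hp1 : p ≤ 1) {L : ℝ} (hpn : L ≤ p * n) :
    (sampleMeasure n p).real {ω | p * (n : ℝ) ^ 3 / 2 < ((sampledT H ω).card : ℝ)} ≤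
      Real.exp (-L) := by
  have := isProbabilityMeasure_sampleMeasure n hp0 hp1
  have hn' : (8 : ℝ) ≤ n := by exact_mod_cast hn
  have hm := card_inducedKeys_cast hH (by omega)
  set m : ℝ := ((inducedKeys H).card : ℝ)
  have hsub : {ω | p * (n : ℝ) ^ 3 / 2 < ((sampledT H ω).card : ℝ)} ⊆
      {ω | 1 / 2 * (p * (n : ℝ) ^ 3 / 4 - p * m) ≤
        ∑ t ∈ inducedKeys H, 1 / 2 * (coin (ω t) - p)} := by
    intro ω hω
    simp only [Set.mem_ofPred_eq, card_sampledT_eq_sum_coin, ← mul_sum, sum_sub_distrib, sum_const,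
      nsmul_eq_mul] at hω ⊢
    linarith
  refine (measureReal_mono hsub).trans ((sampleMeasure_real_le_exp hp0 hp1 (inducedKeys H) id
    Function.injective_id.injOn (fun _ => 1 / 2) _).trans (Real.exp_le_exp.2 ?_))
  have he : Real.exp (1 / 2) - 1 - 1 / 2 ≤ 1 / 4 := by
    have := (le_abs_self _).trans (Real.abs_exp_sub_one_sub_id_le (x := 1 / 2) (by norm_num))
    linarith
  have h1 : p * (m * (Real.exp (1 / 2) - 1 - 1 / 2)) ≤ p * (m * (1 / 4)) := by gcongr
  rw [sum_const, nsmul_eq_mul]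
  have h2 : p * n ≤ p * n * ((3 * n - 2) / 8) :=
    le_mul_of_one_le_right (by positivity) (by linarith)
  have h3 : p * (m * (1 / 4)) - 1 / 2 * (p * (n : ℝ) ^ 3 / 4 - p * m) =
      -(p * n * ((3 * n - 2) / 8)) := by
    rw [hm]; ring
  linarith

lemma card_sampledT_lower_tail {n : ℕ} {H : HTree n} (hH : IsHierarchy H) (hn : 8 ≤ n)
    {p : ℝ} (hp0 : 0 ≤ p) (hp1 : p ≤ 1) {L : ℝ} (hpn : L ≤ p * n) :
    (sampleMeasure n p).real {ω | ((sampledT H ω).card : ℝ) < p * (n : ℝ) ^ 3 / 10} ≤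
      Real.exp (-L) := by
  have := isProbabilityMeasure_sampleMeasure n hp0 hp1
  have hn' : (8 : ℝ) ≤ n := by exact_mod_cast hn
  have hm := card_inducedKeys_cast hH (by omega)
  set m : ℝ := ((inducedKeys H).card : ℝ)
  have hsub : {ω | ((sampledT H ω).card : ℝ) < p * (n : ℝ) ^ 3 / 10} ⊆
      {ω | 1 / 2 * (p * m - p * (n : ℝ) ^ 3 / 20) ≤
        ∑ t ∈ inducedKeys H, (-(1 / 2)) * (coin (ω t) - p)} := by
    intro ω hω
    simp only [Set.mem_ofPred_eq, card_sampledT_eq_sum_coin, ← mul_sum, sum_sub_distrib, sum_const,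
      nsmul_eq_mul] at hω ⊢
    linarith
  refine (measureReal_mono hsub).trans ((sampleMeasure_real_le_exp hp0 hp1 (inducedKeys H) id
    Function.injective_id.injOn (fun _ => -(1 / 2)) _).trans (Real.exp_le_exp.2 ?_))
  have he : Real.exp (-(1 / 2)) - 1 - (-(1 / 2)) ≤ 1 / 8 := by
    have h := Real.quadratic_le_exp_of_nonneg (x := 1 / 2) (by norm_num)
    have h' : (8 : ℝ) / 5 ≤ Real.exp (1 / 2) := by linarith
    rw [Real.exp_neg]
    have := inv_anti₀ (by norm_num) h'
    linarith
  have h1 : p * (m * (Real.exp (-(1 / 2)) - 1 - (-(1 / 2)))) ≤ p * (m * (1 / 8)) := by gcongr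
  rw [sum_const, nsmul_eq_mul]
  have h2 : p * n ≤ p * n * (((n : ℝ) - 1) * (n - 2) / 16 - (n : ℝ) ^ 2 / 40) :=
    le_mul_of_one_le_right (by positivity) (by nlinarith)
  have h3 : p * (m * (1 / 8)) - 1 / 2 * (p * m - p * (n : ℝ) ^ 3 / 20) =
      -(p * n * (((n : ℝ) - 1) * (n - 2) / 16 - (n : ℝ) ^ 2 / 40)) := by
    rw [hm]; ring
  linarith

lemma card_pairs_lt {n : ℕ} (hn : 0 < n) : (pairs n).card < n ^ 2 := by
  have : pairs n ⊂ univ :=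
    (ssubset_univ_iff).2 fun h => by
      have : ((⟨0, hn⟩, ⟨0, hn⟩) : Fin n × Fin n) ∈ pairs n := h ▸ mem_univ _
      simp [pairs] at this
  simpa [sq] using card_lt_card this

/-- with probability `≥ 1 − 2n^{−α}`, both `p·n³/10 ≤ |T| ≤ p·n³/2` and
`max_{i<j} |s_{ij} − p·s_{0ij}| ≤ 4√((α+2)·p·n·log n)` hold. -/
theorem sampled_AddS3_concentration {n : ℕ} (hn : 8 ≤ n)
    (H0 : HTree n) (hH0 : IsHierarchy H0)
    (p : ℝ) (hp0 : 0 < p) (hp1 : p ≤ 1) (α : ℝ) (hα : 0 < α)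
    (hpn : p > (α + 2) * Real.log n / n) :
    ENNReal.ofReal (1 - 2 * (n : ℝ) ^ (-α)) ≤
      sampleMeasure n p {ω |
        (p * (n : ℝ) ^ 3 / 10 ≤ ((sampledT H0 ω).card : ℝ) ∧
          ((sampledT H0 ω).card : ℝ) ≤ p * (n : ℝ) ^ 3 / 2) ∧
        ∀ i j : Fin n, i < j →
          |((sAddS3 (sampledT H0 ω) i j : ℝ)) -
              p * (sAddS3 (inducedTriplets H0) i j : ℝ)| ≤
            4 * Real.sqrt ((α + 2) * p * (n : ℝ) * Real.log n)} := by
  have := isProbabilityMeasure_sampleMeasure n hp0.le hp1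
  have hn' : (8 : ℝ) ≤ n := by exact_mod_cast hn
  have hn0 : (0 : ℝ) < n := by linarith
  set L := (α + 2) * Real.log n with hLdef
  have hL : 0 < L := mul_pos (by linarith) (Real.log_pos (by linarith))
  have hLpn : L ≤ p * n := by
    rw [gt_iff_lt, div_lt_iff₀ hn0] at hpn
    exact hpn.le
  have hexp : (n : ℝ) ^ 2 * Real.exp (-L) = (n : ℝ) ^ (-α) := by
    have : Real.exp (-L) = (n : ℝ) ^ (-α - 2) := by
      rw [Real.rpow_def_of_pos hn0, hLdef]; congr 1; ring
    rw [this, ← Real.rpow_natCast, ← Real.rpow_add hn0]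
    congr 1; push_cast; ring
  have hroot : (α + 2) * p * (n : ℝ) * Real.log n = L * (p * n) := by rw [hLdef]; ring
  rw [hroot]
  set G : Set (Triplet n → Bool) := {ω |
    (p * (n : ℝ) ^ 3 / 10 ≤ ((sampledT H0 ω).card : ℝ) ∧
      ((sampledT H0 ω).card : ℝ) ≤ p * (n : ℝ) ^ 3 / 2) ∧
    ∀ i j : Fin n, i < j →
      |((sAddS3 (sampledT H0 ω) i j : ℝ)) - p * (sAddS3 (inducedTriplets H0) i j : ℝ)| ≤
        4 * Real.sqrt (L * (p * n))} with hG
  have hcompl : Gᶜ ⊆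
      ({ω | ((sampledT H0 ω).card : ℝ) < p * (n : ℝ) ^ 3 / 10} ∪
        {ω | p * (n : ℝ) ^ 3 / 2 < ((sampledT H0 ω).card : ℝ)}) ∪
      ⋃ q ∈ pairs n, {ω | 4 * Real.sqrt (L * (p * n)) <
        |(sAddS3 (sampledT H0 ω) q.1 q.2 : ℝ) -
          p * (sAddS3 (inducedTriplets H0) q.1 q.2 : ℝ)|} := by
    intro ω hω
    by_contra hcon
    simp only [Set.mem_union, Set.mem_iUnion, Set.mem_ofPred_eq, not_or, not_lt, not_exists] at hcon
    exact hω ⟨hcon.1, fun i j hij => hcon.2 (i, j) (by simpa [pairs] using hij)⟩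
  have hpairs : (sampleMeasure n p).real (⋃ q ∈ pairs n, {ω | 4 * Real.sqrt (L * (p * n)) <
        |(sAddS3 (sampledT H0 ω) q.1 q.2 : ℝ) -
          p * (sAddS3 (inducedTriplets H0) q.1 q.2 : ℝ)|}) ≤
      (pairs n).card * (2 * Real.exp (-L)) := by
    refine (measureReal_biUnion_finset_le _ _).trans ?_
    rw [← nsmul_eq_mul]
    refine sum_le_card_nsmul _ _ _ fun q hq => ?_
    simp only [pairs, mem_filter] at hq
    exact sAddS3_tail hH0 hp0.le hp1 hL hLpn hq.2.ne
  have hlow := card_sampledT_lower_tail hH0 hn hp0.le hp1 hLpn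
  have hupp := card_sampledT_upper_tail hH0 hn hp0.le hp1 hLpn
  have hcard : ((pairs n).card : ℝ) + 1 ≤ (n : ℝ) ^ 2 := by
    exact_mod_cast card_pairs_lt (show 0 < n by omega)
  have hbad : (sampleMeasure n p).real Gᶜ ≤ 2 * (n : ℝ) ^ (-α) := by
    have h1 := (measureReal_mono (μ := sampleMeasure n p) hcompl).trans (measureReal_union_le _ _)
    have h2 := measureReal_union_le (μ := sampleMeasure n p)
      {ω | ((sampledT H0 ω).card : ℝ) < p * (n : ℝ) ^ 3 / 10}
      {ω | p * (n : ℝ) ^ 3 / 2 < ((sampledT H0 ω).card : ℝ)}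
    have h3 := mul_le_mul_of_nonneg_right hcard (Real.exp_nonneg (-L))
    linarith
  rw [probReal_compl_eq_one_sub (Set.toFinite G).measurableSet] at hbad
  rw [ENNReal.ofReal_le_iff_le_toReal (measure_ne_top _ _)]
  change _ ≤ (sampleMeasure n p).real G
  linarith

end CompHC
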